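/- arXiv:1902.01166 — 2 statements merged into one kernel-verified Lean document; each statement's English description precedes it below -/
import Mathlib

section
/- For every integer k ≥ 1, ∫₀¹ ψ_k(x)² dx = k(k+1)(k+2)(k+3)/(2k+3). -/
open Polynomial

/-- The Jacobi-type polynomial sequence: G 1 = 1, G 2 = X - 1/2, and for k ≥ 3,
    G k = (X - 1/2)·G (k-1) - ((k-2)(k+2)/(4(2k-1)(2k+1)))·G (k-2). -/
noncomputable def G : ℕ → Polynomial ℝ
  | 0 => 0
  | 1 => 1
  | 2 => Polynomial.X - Polynomial.C (1/2)
  | (k+3) =>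
      (Polynomial.X - Polynomial.C (1/2)) * G (k+2)
        - Polynomial.C ((((k:ℝ)+1)*((k:ℝ)+5))/(4*(2*(k:ℝ)+5)*(2*(k:ℝ)+7))) * G (k+1)

/-- ψ_k = ((2k+2)!/((k−1)!·(k+1)!))·X(1−X)·G_k. -/
noncomputable def psi (k : ℕ) : Polynomial ℝ :=
  Polynomial.C ((Nat.factorial (2*k+2) : ℝ) /
      ((Nat.factorial (k-1) : ℝ) * (Nat.factorial (k+1) : ℝ)))
    * (Polynomial.X * (1 - Polynomial.X)) * G k


noncomputable def bb (n : ℕ) : ℝ := (n:ℝ)*((n:ℝ)+4)/(4*(2*(n:ℝ)+3)*(2*(n:ℝ)+5))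

lemma G_rec (n : ℕ) : G (n+2) = (X - C (1/2)) * G (n+1) - C (bb n) * G n := by
  cases n with
  | zero => simp [G]
  | succ k =>
    rw [show k+1+2 = k+3 from rfl, G]
    congr 3
    unfold bb
    push_cast
    congr 1 <;> ring

lemma G_eval_rec (n : ℕ) (x : ℝ) :
    (G (n+2)).eval x = (x - 1/2) * (G (n+1)).eval x - bb n * (G n).eval x := by
  rw [G_rec]; simp

lemma G_struct (x : ℝ) (n : ℕ) :
    x*(1-x) * (derivative (G (n+1))).eval x
      = -(n:ℝ) * (x-1/2) * (G (n+1)).eval x + (2*(n:ℝ)+5) * bb n * (G n).eval x := by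
  induction n using Nat.twoStepInduction with
  | zero => simp [G]
  | one => simp [G, bb]; ring
  | more n ih0 ih1 =>
    have hd : (derivative (G (n+2+1))).eval x = (G (n+2)).eval x
        + (x-1/2) * (derivative (G (n+2))).eval x
        - bb (n+1) * (derivative (G (n+1))).eval x := by
      rw [show n+2+1 = (n+1)+2 from rfl, G_rec]
      simp only [derivative_sub, derivative_mul, derivative_X, derivative_C, eval_sub, eval_add,
        eval_mul, eval_X, eval_C, eval_one, eval_zero]
      ring
    have r1 := G_eval_rec n x
    have r2 := G_eval_rec (n+1) x
    simp only [Nat.add_assoc, Nat.reduceAdd] at *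
    rw [hd, r2]
    have hb : (1:ℝ)/4 + (2*(n:ℝ)+5) * bb (n+1) = (2*(n:ℝ)+9) * bb (n+2) := by
      unfold bb; push_cast; field_simp; ring
    push_cast at *
    linear_combination (x-1/2) * ih1 - bb (n+1) * ih0 + (G (n+2)).eval x * hb
      - (2*(n:ℝ)+5) * bb (n+1) * r1

noncomputable def II (f : ℝ → ℝ) : ℝ := ∫ x in (0:ℝ)..1, (x*(1-x))^2 * f x

noncomputable def gg (n : ℕ) (x : ℝ) : ℝ := (G n).eval x

lemma gg_cont (n : ℕ) : Continuous (gg n) := (G n).continuous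

lemma II_lin (a b : ℝ) (f g : ℝ → ℝ) (hf : Continuous f) (hg : Continuous g) :
    II (fun x => a * f x + b * g x) = a * II f + b * II g := by
  unfold II
  rw [← intervalIntegral.integral_const_mul, ← intervalIntegral.integral_const_mul,
    ← intervalIntegral.integral_add]
  · congr 1; ext x; ring
  · exact Continuous.intervalIntegrable (by fun_prop) _ _
  · exact Continuous.intervalIntegrable (by fun_prop) _ _

lemma II_deriv (q : ℝ[X]) :
    II (fun x => x*(1-x) * (derivative q).eval x - 6 * (x-1/2) * q.eval x) = 0 := by
  unfold II
  have := intervalIntegral.integral_eq_sub_of_hasDerivAt (a := 0) (b := 1)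
    (f := fun x => ((X*(1-X))^3 * q : ℝ[X]).eval x)
    (f' := fun x => (derivative ((X*(1-X))^3 * q : ℝ[X])).eval x)
    (fun x _ => Polynomial.hasDerivAt _ x)
    (Polynomial.continuous _ |>.intervalIntegrable _ _)
  simp only [eval_mul, eval_pow, eval_X, eval_sub, eval_one] at this
  rw [show ∀ a b : ℝ, (1*(1-1):ℝ)^3 * a - (0*(1-0):ℝ)^3*b = 0 by intros; ring] at this
  rw [← this]
  congr 1; ext x
  simp [derivative_pow]
  ring

lemma gg_rec (n : ℕ) (x : ℝ) :
    gg (n+2) x = (x - 1/2) * gg (n+1) x - bb n * gg n x := G_eval_rec n x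

/-- First relation. -/
lemma rel1 (n : ℕ) : II (fun x => gg (n+2) x * gg (n+2) x) + bb n * II (fun x => gg (n+2) x * gg n x)
    = II (fun x => gg (n+3) x * gg (n+1) x)
      + bb (n+1) * II (fun x => gg (n+1) x * gg (n+1) x) := by
  have c := gg_cont
  have h1 := II_lin 1 (bb n) (fun x => gg (n+2) x * gg (n+2) x) (fun x => gg (n+2) x * gg n x)
    (by fun_prop) (by fun_prop)
  have h2 := II_lin 1 (bb (n+1)) (fun x => gg (n+3) x * gg (n+1) x)
    (fun x => gg (n+1) x * gg (n+1) x) (by fun_prop) (by fun_prop)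
  rw [one_mul] at h1 h2
  rw [← h1, ← h2]
  congr 1; ext x
  have r1 := gg_rec n x
  have r2 := gg_rec (n+1) x
  simp only [Nat.add_assoc, Nat.reduceAdd] at *
  rw [r2]
  linear_combination gg (n+2) x * r1

lemma rel2 (n : ℕ) : (2*(n:ℝ)+7) * II (fun x => gg (n+2) x * gg (n+2) x)
      + 2 * bb n * II (fun x => gg (n+2) x * gg n x)
    = (2*(n:ℝ)+7) * bb (n+1) * II (fun x => gg (n+1) x * gg (n+1) x) := by
  have c := gg_cont
  have h1 := II_lin (2*(n:ℝ)+7) (2*bb n) (fun x => gg (n+2) x * gg (n+2) x)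
    (fun x => gg (n+2) x * gg n x) (by fun_prop) (by fun_prop)
  have h2 := II_lin 1 (-((2*(n:ℝ)+7) * bb (n+1))) 
    (fun x => (2*(n:ℝ)+7) * (gg (n+2) x * gg (n+2) x) + (2*bb n) * (gg (n+2) x * gg n x))
    (fun x => gg (n+1) x * gg (n+1) x) (by fun_prop) (by fun_prop)
  have h3 := II_deriv (G (n+2) * G (n+1))
  have h4 := II_lin (-1) 0 (fun x => x*(1-x) * (derivative (G (n+2) * G (n+1))).eval x
    - 6 * (x-1/2) * (G (n+2) * G (n+1)).eval x) (fun _ => 0) (by fun_prop) (by fun_prop)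
  rw [h3] at h4
  suffices h : II (fun x => 1 * ((2*(n:ℝ)+7) * (gg (n+2) x * gg (n+2) x)
      + (2*bb n) * (gg (n+2) x * gg n x))
      + (-((2*(n:ℝ)+7) * bb (n+1))) * (gg (n+1) x * gg (n+1) x)) = 0 by
    rw [h, h1] at h2
    linarith
  have h5 : ∀ a : ℝ, -1 * 0 + 0 * a = 0 := by intro a; ring
  rw [h5] at h4
  rw [← h4]
  congr 1; ext x
  have r1 := gg_rec n x
  have s0 := G_struct x n
  have s1 := G_struct x (n+1)
  simp only [derivative_mul, eval_add, eval_mul]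
  change _ = _ * gg (n+1) x + _ at s0
  unfold gg at *
  simp only [Nat.add_assoc, Nat.reduceAdd] at *
  push_cast at *
  linear_combination (G (n+1)).eval x * s1 + (G (n+2)).eval x * s0
    + (2*(n:ℝ)+7) * (G (n+2)).eval x * r1

lemma f_zero (n : ℕ) : II (fun x => gg (n+2) x * gg n x) = 0 := by
  induction n with
  | zero => simp [gg, G, II]
  | succ n ih =>
    have h1 := rel1 n
    have h2 := rel2 n
    rw [ih] at h1 h2
    have hp : (2*(n:ℝ)+7) ≠ 0 := by positivity
    apply mul_left_cancel₀ hp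
    simp only [Nat.add_assoc, Nat.reduceAdd] at *
    linear_combination h2 - (2*(n:ℝ)+7) * h1

lemma h_rec (n : ℕ) : II (fun x => gg (n+2) x * gg (n+2) x)
    = bb (n+1) * II (fun x => gg (n+1) x * gg (n+1) x) := by
  have h1 := rel1 n
  have h3 := f_zero (n+1)
  simp only [Nat.add_assoc, Nat.reduceAdd] at *
  rw [f_zero n, h3] at h1
  linarith

noncomputable def cc (n : ℕ) : ℝ := (Nat.factorial (2*n+4) : ℝ) /
      ((Nat.factorial n : ℝ) * (Nat.factorial (n+2) : ℝ))

lemma cc_rec (n : ℕ) : cc (n+1) = cc n * ((2*n+6)*(2*n+5)/((n+1)*(n+3))) := by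
  unfold cc
  rw [show 2*(n+1)+4 = 2*n+4+1+1 by ring, show n+1+2 = n+2+1 by ring]
  simp only [Nat.factorial_succ (2*n+4+1), Nat.factorial_succ (2*n+4), Nat.factorial_succ n,
    Nat.factorial_succ (n+2)]
  have := Nat.factorial_ne_zero n
  have := Nat.factorial_ne_zero (n+2)
  push_cast
  field_simp
  ring

lemma main_norm (n : ℕ) : cc n ^ 2 * II (fun x => gg (n+1) x * gg (n+1) x)
    = ((n:ℝ)+1)*((n:ℝ)+2)*((n:ℝ)+3)*((n:ℝ)+4)/(2*(n:ℝ)+5) := by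
  induction n with
  | zero =>
    have : II (fun x => gg (0+1) x * gg (0+1) x) = 1/30 := by
      have e : ∀ x : ℝ, (x*(1-x))^2 = x^2 - 2*x^3 + x^4 := by intro x; ring
      simp only [II, gg, G, eval_one, mul_one, e]
      rw [intervalIntegral.integral_add, intervalIntegral.integral_sub,
        intervalIntegral.integral_const_mul]
      · simp only [integral_pow]; norm_num
      all_goals exact Continuous.intervalIntegrable (by fun_prop) _ _
    rw [this]
    norm_num [cc, Nat.factorial]
  | succ n ih =>
    have h := h_rec n
    rw [show n+1+1 = n+2 from rfl, h, cc_rec]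
    rw [show ∀ a b c d : ℝ, (a*b)^2*(c*d) = b^2*c*(a^2*d) by intros; ring, ih]
    unfold bb
    push_cast
    field_simp
    ring

/-- L²(0,1)-norm of ψ_k. -/
theorem psi_norm (k : ℕ) (hk : 1 ≤ k) :
    (∫ x in (0:ℝ)..1, ((psi k).eval x)^2)
      = (k:ℝ)*((k:ℝ)+1)*((k:ℝ)+2)*((k:ℝ)+3)/(2*(k:ℝ)+3) := by
  obtain ⟨n, rfl⟩ : ∃ n, k = n+1 := ⟨k-1, by omega⟩
  have h := main_norm n
  unfold II at h
  rw [← intervalIntegral.integral_const_mul] at h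
  have e : ∀ x : ℝ, ((psi (n+1)).eval x)^2
      = cc n ^ 2 * ((x*(1-x))^2 * (gg (n+1) x * gg (n+1) x)) := by
    intro x
    have : (psi (n+1)).eval x = cc n * (x*(1-x)) * gg (n+1) x := by
      unfold psi
      simp only [eval_mul, eval_C, eval_X, eval_sub, eval_one]
      rfl
    rw [this]; ring
  simp only [e]
  rw [h]
  push_cast
  congr 1 <;> ring
end

section
/- For every integer k ≥ 1, ∫₀¹ (1−x)·ψ_k(x) dx = (−1)^{k−1}. -/
open Polynomial

noncomputable def JI (p : Polynomial ℝ) : ℝ := ∫ x in (0:ℝ)..1, p.eval x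

lemma JI_ii (p : Polynomial ℝ) : IntervalIntegrable (fun x => p.eval x) MeasureTheory.volume 0 1 :=
  p.continuous.intervalIntegrable _ _

lemma JI_add (p q : Polynomial ℝ) : JI (p + q) = JI p + JI q := by
  unfold JI
  rw [← intervalIntegral.integral_add (JI_ii p) (JI_ii q)]
  simp

lemma JI_C (c : ℝ) (p : Polynomial ℝ) : JI (C c * p) = c * JI p := by
  unfold JI
  rw [← intervalIntegral.integral_const_mul]
  simp

lemma JI_der (p : Polynomial ℝ) : JI (derivative p) = p.eval 1 - p.eval 0 := by
  unfold JI
  exact intervalIntegral.integral_eq_sub_of_hasDerivAt (fun x _ => p.hasDerivAt x) (JI_ii _)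

lemma G_rec_s7 (k : ℕ) (x : ℝ) : (G (k+3)).eval x = (x - 1/2) * (G (k+2)).eval x
    - (((k:ℝ)+1)*((k:ℝ)+5))/(4*(2*(k:ℝ)+5)*(2*(k:ℝ)+7)) * (G (k+1)).eval x := by
  rw [G]; simp only [eval_sub, eval_mul, eval_X, eval_C]

lemma G_rec' (k : ℕ) (x : ℝ) : (derivative (G (k+3))).eval x = (G (k+2)).eval x
    + (x - 1/2) * (derivative (G (k+2))).eval x
    - (((k:ℝ)+1)*((k:ℝ)+5))/(4*(2*(k:ℝ)+5)*(2*(k:ℝ)+7)) * (derivative (G (k+1))).eval x := by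
  rw [G]; simp only [derivative_sub, derivative_mul, derivative_X, derivative_C, eval_add, eval_sub,
    eval_mul, eval_X, eval_C, eval_one, eval_zero]; ring

lemma G_two (x : ℝ) : (G 2).eval x = x - 1/2 := by
  rw [G]; simp only [eval_sub, eval_X, eval_C]

lemma G_str (n : ℕ) (x : ℝ) :
    x * (1-x) * (derivative (G (n+2))).eval x = -((n:ℝ)+1) * (x-1/2) * (G (n+2)).eval x
      + ((n:ℝ)+1)*((n:ℝ)+5)/(4*(2*(n:ℝ)+5)) * (G (n+1)).eval x := by
  induction n using Nat.twoStepInduction with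
  | zero => simp [G]; ring
  | one =>
    rw [G_rec' 0, G_rec_s7 0]
    simp [G]; ring
  | more n ih1 ih2 =>
    have e1 := G_rec' (n+1) x
    have e2 := G_rec_s7 (n+1) x
    have e3 := G_rec_s7 n x
    have h5 : (2*(n:ℝ)+5) ≠ 0 := by positivity
    have h7 : (2*(n:ℝ)+7) ≠ 0 := by positivity
    have h9 : (2*(n:ℝ)+9) ≠ 0 := by positivity
    have e7 : (2*((n:ℝ)+1)+5) = 2*(n:ℝ)+7 := by ring
    have e9 : (2*((n:ℝ)+1)+7) = 2*(n:ℝ)+9 := by ring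
    have e9' : (2*((n:ℝ)+2)+5) = 2*(n:ℝ)+9 := by ring
    simp only [show n+1+3 = n+2+2 by ring, show n+1+2 = n+3 by ring, show n+1+1 = n+2 by ring,
      show n+2+1=n+3 by ring] at e1 e2 ih2 ⊢
    push_cast at e1 e2 ih2 ⊢
    rw [e7] at ih2
    rw [e7, e9] at e1 e2
    rw [e9', e1, e2]
    generalize (G (n+2+2)).eval x = a at *
    generalize (G (n+3)).eval x = b at *
    generalize (G (n+2)).eval x = c at *
    generalize (G (n+1)).eval x = d at *
    generalize (derivative (G (n+3))).eval x = b' at *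
    generalize (derivative (G (n+2))).eval x = c' at *
    have key : ((n:ℝ)+1)*((n:ℝ)+5)/(4*(2*(n:ℝ)+5)) * d = (2*n+7) * ((x-1/2)*c - b) := by
      rw [e3]; field_simp; ring
    rw [key] at ih1
    have : x * (1-x) * (b + (x-1/2)*b' - ((n:ℝ)+1+1)*((n:ℝ)+1+5)/(4*(2*n+7)*(2*n+9)) * c')
      = x*(1-x)*b + (x-1/2)*(x*(1-x)*b') - ((n:ℝ)+1+1)*((n:ℝ)+1+5)/(4*(2*n+7)*(2*n+9)) * (x*(1-x)*c') := by ring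
    rw [this, ih1, ih2]
    field_simp
    ring

noncomputable def wt : Polynomial ℝ := X^2*(1-X)^2

lemma JI_rec (k : ℕ) (q : Polynomial ℝ) : JI (q * G (k+3)) = JI (q * ((X - C (1/2)) * G (k+2)))
    - (((k:ℝ)+1)*((k:ℝ)+5))/(4*(2*(k:ℝ)+5)*(2*(k:ℝ)+7)) * JI (q * G (k+1)) := by
  rw [sub_eq_add_neg, ← neg_mul, ← JI_C, ← JI_add]
  congr 1
  apply Polynomial.funext
  intro x
  simp only [eval_add, eval_mul, eval_C, G_rec_s7, eval_sub, eval_X]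
  ring

lemma JI_y (n : ℕ) : ((n:ℝ)+7) * JI (wt * ((X - C (1/2)) * G (n+2)))
    = ((n:ℝ)+1)*((n:ℝ)+5)/(4*(2*(n:ℝ)+5)) * JI (wt * G (n+1)) := by
  have h := JI_der ((X*(1-X))^3 * G (n+2))
  have e : derivative ((X*(1-X))^3 * G (n+2)) = C (-((n:ℝ)+7)) * (wt * ((X - C (1/2)) * G (n+2)))
      + C (((n:ℝ)+1)*((n:ℝ)+5)/(4*(2*(n:ℝ)+5))) * (wt * G (n+1)) := by
    apply Polynomial.funext
    intro x
    have := G_str n x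
    simp [derivative_pow, wt] at this ⊢
    linear_combination (x*(1-x))^2 * this
  rw [e, JI_add, JI_C, JI_C] at h
  simp at h
  linarith

lemma JI_orth (n : ℕ) : JI (wt * G (n+2)) = 0 := by
  induction n using Nat.twoStepInduction with
  | zero =>
    have h := JI_der (C (-1/6) * (X*(1-X))^3)
    have e : derivative (C (-1/6) * (X*(1-X))^3) = wt * G (0+2) := by
      apply Polynomial.funext
      intro x
      simp [derivative_pow, wt, G]
      ring
    rw [e] at h
    simpa using h
  | one =>
    rw [JI_rec 0 wt]
    have := JI_y 0
    norm_num at this ⊢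
    linarith
  | more n ih1 _ =>
    have h := JI_rec (n+1) wt
    have h2 := JI_y (n+1)
    rw [show n+1+1 = n+2 by ring, ih1] at h h2
    rw [show n+2+2=n+1+3 by ring, h]
    have : (((n+1:ℕ):ℝ)+7) ≠ 0 := by positivity
    simp at h2
    rcases h2 with h2 | h2
    · exfalso; apply this; push_cast; exact h2
    · simp [h2]

lemma JI_main (n : ℕ) : JI (X*(1-X)^2 * G (n+1)) =
    (-1)^n * ((n.factorial : ℝ) * ((n+2).factorial : ℝ)) / ((2*n+4).factorial : ℝ) := by
  have step : ∀ n, JI (X*(1-X)^2 * ((X - C (1/2)) * G (n+1))) = JI (wt * G (n+1)) - 1/2 * JI (X*(1-X)^2 * G (n+1)) := by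
    intro n
    rw [sub_eq_add_neg (JI _), ← neg_mul, ← JI_C, ← JI_add]
    congr 1
    apply Polynomial.funext
    intro x
    simp [wt]
    ring
  have h0 : JI (X*(1-X)^2 * G (0+1)) = 1/12 := by
    have h := JI_der (C (1/2) * X^2 - C (2/3) * X^3 + C (1/4) * X^4)
    rw [show X*(1-X)^2 * G (0+1) = derivative (C (1/2) * X^2 - C (2/3) * X^3 + C (1/4) * X^4 : ℝ[X]) by
      apply Polynomial.funext
      intro x
      simp [G]
      ring, h]
    norm_num
  have hw : JI (wt * G (0+1)) = 1/30 := by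
    have h := JI_der (C (1/3) * X^3 - C (1/2) * X^4 + C (1/5) * X^5)
    rw [show wt * G (0+1) = derivative (C (1/3) * X^3 - C (1/2) * X^4 + C (1/5) * X^5 : ℝ[X]) by
      apply Polynomial.funext
      intro x
      simp [G, wt]
      ring, h]
    norm_num
  induction n using Nat.twoStepInduction with
  | zero => rw [h0]; norm_num [Nat.factorial]
  | one =>
    have e : X*(1-X)^2 * G (1+1) = X*(1-X)^2 * ((X - C (1/2)) * G (0+1)) := by simp [G]
    rw [e, step, h0, hw]; norm_num [Nat.factorial]
  | more n ih1 ih2 =>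
    rw [show n+2+1 = n+3 by ring, JI_rec, show n+2 = n+1+1 by ring, step, ih1, ih2, JI_orth]
    have f1 : (((2*(n+1+1)+4).factorial : ℕ):ℝ) = (2*n+8)*((2*n+7)*((2*n+6)*((2*n+5)*((2*n+4).factorial:ℝ)))) := by
      rw [show 2*(n+1+1)+4 = 2*n+4+1+1+1+1 by ring]
      simp only [Nat.factorial_succ (2*n+4+1+1+1), Nat.factorial_succ (2*n+4+1+1), Nat.factorial_succ (2*n+4+1), Nat.factorial_succ (2*n+4)]; push_cast; ring
    have f2 : (((2*(n+1)+4).factorial : ℕ):ℝ) = ((2*n+6)*((2*n+5)*((2*n+4).factorial:ℝ))) := by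
      rw [show 2*(n+1)+4 = 2*n+4+1+1 by ring]
      simp only [Nat.factorial_succ (2*n+4+1), Nat.factorial_succ (2*n+4)]; push_cast; ring
    have f3 : (((n+1+1+2).factorial : ℕ):ℝ) = (n+4)*((n+3)*((n+2).factorial:ℝ)) := by
      rw [show n+1+1+2 = n+2+1+1 by ring]
      simp only [Nat.factorial_succ (n+2+1), Nat.factorial_succ (n+2)]; push_cast; ring
    have f4 : (((n+1+2).factorial : ℕ):ℝ) = ((n+3)*((n+2).factorial:ℝ)) := by
      rw [show n+1+2 = n+2+1 by ring]
      simp only [Nat.factorial_succ (n+2)]; push_cast; ring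
    have f5 : (((n+1+1).factorial : ℕ):ℝ) = (n+2)*((n+1)*(n.factorial:ℝ)) := by
      simp only [Nat.factorial_succ (n+1), Nat.factorial_succ n]; push_cast; ring
    have f6 : (((n+1).factorial : ℕ):ℝ) = ((n+1)*(n.factorial:ℝ)) := by
      simp only [Nat.factorial_succ n]; push_cast; ring
    rw [f1, f2, f3, f4, f5, f6, show n+1+1 = n+2 by ring]
    have hF : ((2*n+4).factorial:ℝ) ≠ 0 := by positivity
    generalize ((2*n+4).factorial:ℝ) = F at *
    generalize ((n+2).factorial:ℝ) = A at *
    generalize (n.factorial:ℝ) = B at *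
    rw [pow_succ (-1:ℝ) n, pow_add (-1:ℝ) n 2]
    generalize (-1:ℝ)^n = S
    have h5 : (2*(n:ℝ)+5) ≠ 0 := by positivity
    have h6 : (2*(n:ℝ)+6) ≠ 0 := by positivity
    have h7 : (2*(n:ℝ)+7) ≠ 0 := by positivity
    have h8 : (2*(n:ℝ)+8) ≠ 0 := by positivity
    field_simp
    ring

/-- ∫₀¹ (1−x)·ψ_k(x) dx = (−1)^{k−1}. -/
theorem psi_inner_one_sub_x (k : ℕ) (hk : 1 ≤ k) :
    (∫ x in (0:ℝ)..1, (1-x) * (psi k).eval x) = (-1:ℝ)^(k-1) := by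
  obtain ⟨n, rfl⟩ : ∃ n, k = n + 1 := ⟨k-1, by omega⟩
  have h := JI_C ((Nat.factorial (2*(n+1)+2) : ℝ) /
      ((Nat.factorial (n+1-1) : ℝ) * (Nat.factorial (n+1+1) : ℝ))) (X*(1-X)^2 * G (n+1))
  rw [JI_main] at h
  have e : (∫ x in (0:ℝ)..1, (1-x) * (psi (n+1)).eval x) =
      JI (C ((Nat.factorial (2*(n+1)+2) : ℝ) /
      ((Nat.factorial (n+1-1) : ℝ) * (Nat.factorial (n+1+1) : ℝ))) * (X*(1-X)^2 * G (n+1))) := by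
    unfold JI
    congr 1
    ext x
    simp only [psi, eval_mul, eval_C, eval_X, eval_sub, eval_one, eval_pow]
    ring
  rw [e, h, show 2*(n+1)+2 = 2*n+4 by ring, show n+1-1 = n by omega, show n+1+1=n+2 by ring]
  field_simp
end
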